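/- On a symplectic vector space (V, Ω) of dimension 2n, the map ⊤: Λᵏ(V*) → Λᵏ⁺²(V*), ω ↦ ω ∧ Ω, is injective for k ≤ n−1. -/

import Mathlib

/- Framework: exterior forms on a real vector space `V` are modelled as elements of the
exterior algebra of the dual space; a `k`-form is an element of the submodule
`⋀[ℝ]^k (Module.Dual ℝ V)`, and the wedge product is the algebra multiplication. -/

noncomputable section
open ExteriorAlgebra
set_option synthInstance.maxHeartbeats 1000000
set_option maxHeartbeats 1000000

variable (V : Type) [AddCommGroup V] [Module ℝ V]

/-- The algebra of exterior forms on `V`. -/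
abbrev EForm := ExteriorAlgebra ℝ (Module.Dual ℝ V)

variable {V}

/-- Interior product (contraction) of forms by a vector, linear in the vector. -/
def iContrL : V →ₗ[ℝ] Module.End ℝ (EForm V) :=
  (CliffordAlgebra.contractLeft (Q := (0 : QuadraticForm ℝ (Module.Dual ℝ V)))).comp
    (Module.Dual.eval ℝ V)

/-- Contraction of forms by an arbitrary element of the exterior algebra of `V`
(e.g. by a bivector), extending `iContrL` as an algebra morphism. -/
def aContr : ExteriorAlgebra ℝ V →ₐ[ℝ] Module.End ℝ (EForm V) :=
  ExteriorAlgebra.lift ℝ ⟨iContrL, fun _ =>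
    LinearMap.ext fun _ => CliffordAlgebra.contractLeft_contractLeft _ _⟩

/-- The bilinear form on `V` associated with an exterior 2-form, via double contraction
(the scalar part is extracted by `ExteriorAlgebra.algebraMapInv`). -/
def formToBilin (Om : EForm V) : V →ₗ[ℝ] V →ₗ[ℝ] ℝ :=
  LinearMap.mk₂ ℝ (fun x y => algebraMapInv (iContrL y (iContrL x Om)))
    (fun x x' y => by simp [map_add, LinearMap.add_apply])
    (fun c x y => by simp [map_smul, LinearMap.smul_apply])
    (fun x y y' => by simp [map_add, LinearMap.add_apply])
    (fun c x y => by simp [map_smul, LinearMap.smul_apply])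

/-- A 2-form is nondegenerate (symplectic) if its associated bilinear form is. -/
def IsSymplecticForm (Om : EForm V) : Prop :=
  Om ∈ ⋀[ℝ]^2 (Module.Dual ℝ V) ∧ ∀ x : V, (∀ y : V, formToBilin Om x y = 0) → x = 0

/-- The algebra morphism `⋀ V → ⋀ V*` induced by a linear map `Γ : V → V*`. -/
def extAlgMap (f : V →ₗ[ℝ] Module.Dual ℝ V) : ExteriorAlgebra ℝ V →ₐ[ℝ] EForm V :=
  ExteriorAlgebra.lift ℝ ⟨(ExteriorAlgebra.ι ℝ).comp f, fun _ => ι_sq_zero _⟩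

/-- `XOm` is the bivector dual to the symplectic form `Om`, i.e. the unique bivector with
`Γ^*(X_Ω) = Ω` where `Γ : V → V*` is the isomorphism induced by `Om`. -/
def IsDualBivector (Om : EForm V) (XOm : ExteriorAlgebra ℝ V) : Prop :=
  XOm ∈ ⋀[ℝ]^2 V ∧ extAlgMap (formToBilin Om) XOm = Om

/-- The pullback action on forms induced by an endomorphism `K : V → V`. -/
def formPullback (K : V →ₗ[ℝ] V) : EForm V →ₐ[ℝ] EForm V :=
  ExteriorAlgebra.lift ℝ ⟨(ExteriorAlgebra.ι ℝ).comp K.dualMap, fun _ => ι_sq_zero _⟩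

lemma iContrL_ι_mul (x : V) (a : Module.Dual ℝ V) (w : EForm V) :
    iContrL x (ExteriorAlgebra.ι ℝ a * w)
      = a x • w - ExteriorAlgebra.ι ℝ a * iContrL x w :=
  CliffordAlgebra.contractLeft_ι_mul ..

lemma iContrL_algebraMap (x : V) (r : ℝ) : iContrL x (algebraMap ℝ (EForm V) r) = 0 :=
  CliffordAlgebra.contractLeft_algebraMap ..

lemma iContrL_ι (x : V) (a : Module.Dual ℝ V) :
    iContrL x (ExteriorAlgebra.ι ℝ a : EForm V) = algebraMap ℝ (EForm V) (a x) :=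
  CliffordAlgebra.contractLeft_ι ..

lemma iContrL_comm (x y : V) (w : EForm V) :
    iContrL x (iContrL y w) = -iContrL y (iContrL x w) :=
  CliffordAlgebra.contractLeft_comm ..

/-- Induction principle for `k + 1`-forms, peeling off one covector on the left. -/
lemma exteriorPower_succ_induction {k : ℕ} {p : EForm V → Prop}
    (mul : ∀ a : Module.Dual ℝ V, ∀ w ∈ ⋀[ℝ]^k (Module.Dual ℝ V),
      p (ExteriorAlgebra.ι ℝ a * w))
    (add : ∀ u v, p u → p v → p (u + v)) {w : EForm V}
    (hw : w ∈ ⋀[ℝ]^(k + 1) (Module.Dual ℝ V)) : p w := by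
  change w ∈ LinearMap.range (ExteriorAlgebra.ι ℝ) ^ (k + 1) at hw
  rw [pow_succ'] at hw
  refine Submodule.mul_induction_on hw ?_ add
  rintro _ ⟨a, rfl⟩ v hv
  exact mul a v hv

lemma mem_exteriorPower_zero {w : EForm V} (hw : w ∈ ⋀[ℝ]^0 (Module.Dual ℝ V)) :
    ∃ r, algebraMap ℝ (EForm V) r = w := by
  change w ∈ LinearMap.range (ExteriorAlgebra.ι ℝ) ^ 0 at hw
  rw [pow_zero] at hw
  exact Submodule.mem_one.1 hw

/-- Induction principle for 2-forms. -/
lemma two_form_induction {p : EForm V → Prop}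
    (mul : ∀ a b : Module.Dual ℝ V, p (ExteriorAlgebra.ι ℝ a * ExteriorAlgebra.ι ℝ b))
    (add : ∀ u v, p u → p v → p (u + v)) {w : EForm V}
    (hw : w ∈ ⋀[ℝ]^2 (Module.Dual ℝ V)) : p w := by
  refine exteriorPower_succ_induction (k := 1) (fun a v hv => ?_) add hw
  refine exteriorPower_succ_induction (k := 0) (p := fun v => p (ExteriorAlgebra.ι ℝ a * v))
    (fun b u hu => ?_) (fun u v hu hv => by rw [mul_add]; exact add _ _ hu hv) hv
  obtain ⟨r, rfl⟩ := mem_exteriorPower_zero hu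
  have : (ExteriorAlgebra.ι ℝ b * algebraMap ℝ (EForm V) r)
      = ExteriorAlgebra.ι ℝ (r • b) := by
    rw [map_smul, Algebra.smul_def, Algebra.commutes]
  rw [this]
  exact mul a _

lemma iContrL_mem (x : V) (k : ℕ) {w : EForm V}
    (hw : w ∈ ⋀[ℝ]^(k + 1) (Module.Dual ℝ V)) :
    iContrL x w ∈ ⋀[ℝ]^k (Module.Dual ℝ V) := by
  induction k generalizing w with
  | zero =>
    refine exteriorPower_succ_induction (p := fun w => iContrL x w ∈ ⋀[ℝ]^0 (Module.Dual ℝ V))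
      (fun a v hv => ?_)
      (fun u v hu hv => (map_add (iContrL x) u v).symm ▸ add_mem hu hv) hw
    obtain ⟨r, rfl⟩ := mem_exteriorPower_zero hv
    rw [iContrL_ι_mul, iContrL_algebraMap, mul_zero, sub_zero]
    exact Submodule.smul_mem _ _ hv
  | succ k ih =>
    refine exteriorPower_succ_induction (p := fun w => iContrL x w ∈ ⋀[ℝ]^(k + 1) (Module.Dual ℝ V))
      (fun a v hv => ?_)
      (fun u v hu hv => (map_add (iContrL x) u v).symm ▸ add_mem hu hv) hw
    rw [iContrL_ι_mul]
    refine sub_mem (Submodule.smul_mem _ _ hv) ?_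
    change _ ∈ LinearMap.range (ExteriorAlgebra.ι ℝ) ^ (k + 1)
    rw [pow_succ']
    exact Submodule.mul_mem_mul ⟨a, rfl⟩ (ih hv)

/-- A 2-form is central in the exterior algebra. -/
lemma two_form_commute {Om : EForm V} (hOm : Om ∈ ⋀[ℝ]^2 (Module.Dual ℝ V)) (w : EForm V) :
    Om * w = w * Om := by
  have key (c : Module.Dual ℝ V) :
      Om * ExteriorAlgebra.ι ℝ c = ExteriorAlgebra.ι ℝ c * Om := by
    refine two_form_induction (p := fun Om =>
      Om * ExteriorAlgebra.ι ℝ c = ExteriorAlgebra.ι ℝ c * Om) (fun a b => ?_)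
      (fun u v hu hv => by simp only [add_mul, mul_add, hu, hv]) hOm
    have anti (a b : Module.Dual ℝ V) :
        (ExteriorAlgebra.ι ℝ a : EForm V) * ExteriorAlgebra.ι ℝ b
          = -(ExteriorAlgebra.ι ℝ b * ExteriorAlgebra.ι ℝ a) :=
      eq_neg_of_add_eq_zero_left (ExteriorAlgebra.ι_add_mul_swap a b)
    rw [mul_assoc, anti b c, mul_neg, ← mul_assoc, anti a c, neg_mul, neg_neg, mul_assoc]
  induction w using ExteriorAlgebra.induction with
  | algebraMap r => exact (Algebra.commutes r Om).symm
  | ι c => exact key c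
  | mul a b ha hb => rw [← mul_assoc, ha, mul_assoc, hb, mul_assoc]
  | add a b ha hb => rw [mul_add, add_mul, ha, hb]

/-- Contraction by a vector obeys the Leibniz rule on products with a 2-form. -/
lemma iContrL_two_form_mul {Om : EForm V} (hOm : Om ∈ ⋀[ℝ]^2 (Module.Dual ℝ V))
    (x : V) (w : EForm V) : iContrL x (Om * w) = iContrL x Om * w + Om * iContrL x w := by
  refine two_form_induction (p := fun Om =>
    iContrL x (Om * w) = iContrL x Om * w + Om * iContrL x w) (fun a b => ?_)
    (fun u v hu hv => by simp only [add_mul, map_add, hu, hv]; abel) hOm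
  simp only [mul_assoc, iContrL_ι_mul, iContrL_ι, ← Algebra.commutes, ← Algebra.smul_def,
    mul_sub, sub_mul, smul_mul_assoc, mul_smul_comm]
  abel

lemma formToBilin_apply (Om : EForm V) (x y : V) :
    formToBilin Om x y = algebraMapInv (iContrL y (iContrL x Om)) := rfl

lemma formToBilin_swap (Om : EForm V) (x y : V) :
    formToBilin Om x y = -formToBilin Om y x := by
  rw [formToBilin_apply, formToBilin_apply, iContrL_comm, map_neg]

lemma iContrL_two_form {Om : EForm V} (hOm : Om ∈ ⋀[ℝ]^2 (Module.Dual ℝ V)) (x : V) :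
    iContrL x Om = ExteriorAlgebra.ι ℝ (formToBilin Om x : Module.Dual ℝ V) := by
  have hmem : iContrL x Om ∈ LinearMap.range (ExteriorAlgebra.ι ℝ) := by
    have := iContrL_mem x 1 hOm
    rwa [exteriorPower, pow_one] at this
  obtain ⟨a, ha⟩ := hmem
  have : (formToBilin Om x : Module.Dual ℝ V) = a := by
    ext y
    rw [formToBilin_apply, ← ha, iContrL_ι, ExteriorAlgebra.algebraMap_leftInverse]
  rw [this, ha]

section Basis

variable {I : Type} [Fintype I]

/-- Euler's identity for `k`-forms. -/
lemma sum_ι_coord_mul_iContrL (b : Module.Basis I ℝ V) (k : ℕ) {w : EForm V}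
    (hw : w ∈ ⋀[ℝ]^k (Module.Dual ℝ V)) :
    ∑ i, ExteriorAlgebra.ι ℝ (b.coord i) * iContrL (b i) w = (k : ℝ) • w := by
  induction k generalizing w with
  | zero =>
    obtain ⟨r, rfl⟩ := mem_exteriorPower_zero hw
    simp [iContrL_algebraMap]
  | succ k ih =>
    refine exteriorPower_succ_induction (p := fun w =>
      ∑ i, ExteriorAlgebra.ι ℝ (b.coord i) * iContrL (b i) w = ((k + 1 : ℕ) : ℝ) • w)
      (fun a v hv => ?_)
      (fun u v hu hv => by
        simp only [map_add, mul_add, Finset.sum_add_distrib, smul_add, hu, hv]) hw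
    have hswap (i : I) : ExteriorAlgebra.ι ℝ (b.coord i) * iContrL (b i)
          (ExteriorAlgebra.ι ℝ a * v)
        = ExteriorAlgebra.ι ℝ (a (b i) • b.coord i) * v
          + ExteriorAlgebra.ι ℝ a * (ExteriorAlgebra.ι ℝ (b.coord i) * iContrL (b i) v) := by
      have anti := eq_neg_of_add_eq_zero_left
        (ExteriorAlgebra.ι_add_mul_swap (R := ℝ) (b.coord i) a)
      rw [iContrL_ι_mul, mul_sub, ← mul_assoc, anti, neg_mul, mul_assoc, map_smul,
        smul_mul_assoc, mul_smul_comm, sub_neg_eq_add]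
    rw [Finset.sum_congr rfl fun i _ => hswap i, Finset.sum_add_distrib, ← Finset.mul_sum,
      ih hv, ← Finset.sum_mul, ← map_sum, b.sum_dual_apply_smul_coord, mul_smul_comm,
      Nat.cast_succ, add_smul, one_smul, add_comm]

/-- Contraction by the bivector `∑ i, b i ∧ f i`. -/
def bivectorContr (b f : I → V) : Module.End ℝ (EForm V) :=
  ∑ i, iContrL (b i) * iContrL (f i)

lemma bivectorContr_apply (b f : I → V) (w : EForm V) :
    bivectorContr b f w = ∑ i, iContrL (b i) (iContrL (f i) w) := by
  simp [bivectorContr]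

lemma bivectorContr_mem (b f : I → V) (k : ℕ) {w : EForm V}
    (hw : w ∈ ⋀[ℝ]^(k + 2) (Module.Dual ℝ V)) :
    bivectorContr b f w ∈ ⋀[ℝ]^k (Module.Dual ℝ V) := by
  rw [bivectorContr_apply]
  exact sum_mem fun i _ => iContrL_mem _ _ (iContrL_mem _ _ hw)

lemma bivectorContr_eq_zero (b f : I → V) {k : ℕ} (hk : k < 2) {w : EForm V}
    (hw : w ∈ ⋀[ℝ]^k (Module.Dual ℝ V)) : bivectorContr b f w = 0 := by
  rw [bivectorContr_apply]
  refine Finset.sum_eq_zero fun i _ => ?_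
  interval_cases k
  · obtain ⟨r, rfl⟩ := mem_exteriorPower_zero hw
    rw [iContrL_algebraMap, map_zero]
  · obtain ⟨r, hr⟩ := mem_exteriorPower_zero (iContrL_mem (f i) 0 hw)
    rw [← hr, iContrL_algebraMap]

/-- The commutator of exterior multiplication by a symplectic form with contraction by its
inverse bivector. -/
lemma bivectorContr_mul {Om : EForm V} (hOm : IsSymplecticForm Om) (b : Module.Basis I ℝ V)
    (f : I → V) (hf : ∀ i, formToBilin Om (f i) = b.coord i) (k : ℕ) {w : EForm V}
    (hw : w ∈ ⋀[ℝ]^k (Module.Dual ℝ V)) :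
    bivectorContr b f (Om * w) = Om * bivectorContr b f w
      + ((Fintype.card I : ℝ) - 2 * k) • w := by
  have hinv (j : I) : ∑ i, formToBilin Om (b i) (b j) • f i = -b j := by
    rw [← add_eq_zero_iff_eq_neg]
    refine hOm.2 _ fun y => ?_
    have hsum : formToBilin Om (∑ i, formToBilin Om (b i) (b j) • f i)
        = -formToBilin Om (b j) := by
      refine b.ext fun l => ?_
      simp only [map_sum, map_smul, hf, LinearMap.neg_apply]
      rw [formToBilin_swap Om (b j), neg_neg]
      classical
      simp [Finsupp.single_apply]
    rw [map_add, hsum, neg_add_cancel, LinearMap.zero_apply]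
  have hcross : ∑ i, ExteriorAlgebra.ι ℝ (formToBilin Om (b i) : Module.Dual ℝ V)
      * iContrL (f i) w = -((k : ℝ) • w) := by
    rw [← sum_ι_coord_mul_iContrL b k hw, ← Finset.sum_neg_distrib]
    have hexp (i : I) : ExteriorAlgebra.ι ℝ (formToBilin Om (b i) : Module.Dual ℝ V)
        * iContrL (f i) w = ∑ j, ExteriorAlgebra.ι ℝ (b.coord j)
          * iContrL (formToBilin Om (b i) (b j) • f i) w := by
      conv_lhs => rw [← b.sum_dual_apply_smul_coord (formToBilin Om (b i))]
      simp only [map_sum, Finset.sum_mul, map_smul, smul_mul_assoc, LinearMap.smul_apply,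
        mul_smul_comm]
    rw [Finset.sum_congr rfl fun i _ => hexp i, Finset.sum_comm]
    refine Finset.sum_congr rfl fun j _ => ?_
    rw [← Finset.mul_sum, ← LinearMap.sum_apply, ← map_sum, hinv, map_neg,
      LinearMap.neg_apply, mul_neg]
  have hterm (i : I) : iContrL (b i) (iContrL (f i) (Om * w))
      = Om * iContrL (b i) (iContrL (f i) w) + (w
        - ExteriorAlgebra.ι ℝ (b.coord i) * iContrL (b i) w
        + ExteriorAlgebra.ι ℝ (formToBilin Om (b i) : Module.Dual ℝ V) * iContrL (f i) w) := by
    rw [iContrL_two_form_mul hOm.1, map_add, iContrL_two_form_mul hOm.1,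
      iContrL_two_form hOm.1 (f i), hf, iContrL_ι_mul, iContrL_two_form hOm.1 (b i),
      b.coord_apply, b.repr_self, Finsupp.single_eq_same, one_smul]
    abel
  rw [bivectorContr_apply, bivectorContr_apply, Finset.sum_congr rfl fun i _ => hterm i,
    Finset.sum_add_distrib, ← Finset.mul_sum, Finset.sum_add_distrib, Finset.sum_sub_distrib,
    sum_ι_coord_mul_iContrL b k hw, hcross, Finset.sum_const, Finset.card_univ,
    ← Nat.cast_smul_eq_nsmul ℝ]
  module

/-- In degrees at most half the dimension, multiplication by a symplectic form composed with
contraction by its inverse bivector has no negative eigenvalue. -/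
lemma eq_zero_of_mul_bivectorContr {Om : EForm V} (hOm : IsSymplecticForm Om)
    (b : Module.Basis I ℝ V) (f : I → V) (hf : ∀ i, formToBilin Om (f i) = b.coord i)
    (k : ℕ) (hk : 2 * k ≤ Fintype.card I) {c : ℝ} (hc : 0 < c) {w : EForm V}
    (hw : w ∈ ⋀[ℝ]^k (Module.Dual ℝ V))
    (h : Om * bivectorContr b f w + c • w = 0) : w = 0 := by
  induction k using Nat.strong_induction_on generalizing c w with
  | _ k ih =>
    suffices hz : bivectorContr b f w = 0 by
      rw [hz, mul_zero, zero_add] at h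
      exact (smul_eq_zero.1 h).resolve_left hc.ne'
    rcases lt_or_ge k 2 with hk2 | hk2
    · exact bivectorContr_eq_zero b f hk2 hw
    obtain ⟨m, rfl⟩ := Nat.exists_eq_add_of_le' hk2
    have hw' := bivectorContr_mem b f m hw
    have hm : (2 * m : ℝ) ≤ Fintype.card I := by
      exact_mod_cast (show 2 * m ≤ Fintype.card I by omega)
    refine ih m (by omega) (by omega) (c := (Fintype.card I - 2 * m) + c) (by linarith) hw' ?_
    have h2 := congrArg (bivectorContr b f) h
    rwa [map_add, map_smul, map_zero, bivectorContr_mul hOm b f hf m hw', add_assoc,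
      ← add_smul] at h2

end Basis

/-- On a symplectic vector space `(V, Ω)` of dimension `2n`, the map
`⊤ : Λᵏ(V*) → Λᵏ⁺²(V*)`, `ω ↦ ω ∧ Ω`, is injective for `k ≤ n - 1`. -/
theorem top_injective [FiniteDimensional ℝ V] (n k : ℕ)
    (hdim : Module.finrank ℝ V = 2 * n)
    (Om : EForm V) (hOm : IsSymplecticForm Om)
    (hk : k + 1 ≤ n)
    (ω : EForm V) (hω : ω ∈ ⋀[ℝ]^k (Module.Dual ℝ V))
    (h : ω * Om = 0) : ω = 0 := by
  let b := Module.finBasis ℝ V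
  have hinj : Function.Injective (formToBilin Om : V →ₗ[ℝ] Module.Dual ℝ V) := by
    rw [← LinearMap.ker_eq_bot, LinearMap.ker_eq_bot']
    exact fun x hx => hOm.2 x fun y => by rw [hx, LinearMap.zero_apply]
  have hsurj : Function.Surjective (formToBilin Om : V →ₗ[ℝ] Module.Dual ℝ V) :=
    (LinearMap.injective_iff_surjective_of_finrank_eq_finrank
      Subspace.dual_finrank_eq.symm).1 hinj
  choose f hf using fun i => hsurj (b.coord i)
  have hcomm := bivectorContr_mul hOm b f hf k hω
  rw [two_form_commute hOm.1, h, map_zero] at hcomm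
  have hcard : Fintype.card (Fin (Module.finrank ℝ V)) = 2 * n := by
    rw [Fintype.card_fin, hdim]
  have hkn : (k : ℝ) + 1 ≤ n := by exact_mod_cast hk
  refine eq_zero_of_mul_bivectorContr hOm b f hf k (by omega) ?_ hω hcomm.symm
  rw [hcard]
  push_cast
  linarith
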